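/- Let α₁,…,αₙ ∈ 𝔼ⁿ with αᵢ = (α_{i1},…,α_{in}), and suppose the coordinate matrix (α_{ij})_{n×n} is non-singular, i.e. its determinant is zeroless. Then the set {α₁,…,αₙ} is linearly independent. -/

import Mathlib

open scoped Pointwise Classical

noncomputable section

-- Note: `ℝ*` is Mathlib's notation for the hyperreals `Hyperreal`.

/-- A neutrix: an order-convex additive subgroup of the hyperreals. -/
def IsNeutrix (A : Set ℝ*) : Prop :=
  (0 : ℝ*) ∈ A ∧ (∀ x ∈ A, ∀ y ∈ A, x + y ∈ A) ∧ (∀ x ∈ A, -x ∈ A) ∧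
    ∀ x ∈ A, ∀ y ∈ A, ∀ z : ℝ*, x ≤ z → z ≤ y → z ∈ A

/-- The coset `a + A`. -/
def coset (a : ℝ*) (A : Set ℝ*) : Set ℝ* := {x | ∃ u ∈ A, x = a + u}

/-- `α` is an external number: a coset of a neutrix. -/
def IsExt (α : Set ℝ*) : Prop := ∃ a A, IsNeutrix A ∧ α = coset a A

/-- The neutrix part `N(α)` of an external number, as the set of differences. -/
def Nx (α : Set ℝ*) : Set ℝ* := {d | ∃ x ∈ α, ∃ y ∈ α, d = x - y}

/-- An external number is zeroless if it does not contain `0`. -/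
def Zeroless (α : Set ℝ*) : Prop := (0 : ℝ*) ∉ α

/-- Multiplication of external numbers: `αβ = ab + aB + bA + AB`
(independent of the chosen representatives). -/
def emul (α β : Set ℝ*) : Set ℝ* :=
  {z | ∃ a A b B, IsNeutrix A ∧ IsNeutrix B ∧ α = coset a A ∧ β = coset b B ∧
      ∃ u ∈ A, ∃ v ∈ B, ∃ u' ∈ A, ∃ v' ∈ B, z = a * b + a * v + b * u + u' * v'}

/-- Multiplication of an external number by a hyperreal scalar: `t·α = ta + tA`. -/
def esmul (t : ℝ*) (α : Set ℝ*) : Set ℝ* := (fun x => t * x) '' α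

/-- Inverse of a (zeroless) external number: `1/α = 1/a + A/a²`. -/
def einv (α : Set ℝ*) : Set ℝ* :=
  {z | ∃ a A, IsNeutrix A ∧ α = coset a A ∧ ∃ u ∈ A, z = a⁻¹ + u / a ^ 2}

/-- Division of external numbers: `α/β = α · (1/β)`. -/
def ediv (α β : Set ℝ*) : Set ℝ* := emul α (einv β)

/-- The neutrix `⊘` of infinitesimal hyperreals. -/
def oslash : Set ℝ* := {x | Hyperreal.Infinitesimal x}

/-- Relative uncertainty `R(α)`: `A/a` if `α = a + A` is zeroless,
and all of `ℝ*` if `α` is a neutrix. -/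
def RU (α : Set ℝ*) : Set ℝ* :=
  if (0 : ℝ*) ∈ α then Set.univ
  else {z | ∃ a A, IsNeutrix A ∧ α = coset a A ∧ ∃ u ∈ A, z = u / a}

/-- `α` and `β` are nearly opposite: both zeroless and `α/β ⊆ -1 + ⊘`. -/
def NearlyOpposite (α β : Set ℝ*) : Prop :=
  Zeroless α ∧ Zeroless β ∧ ediv α β ⊆ coset (-1) oslash

/-- Order on external numbers: `α ≤ β` iff `∀ x ∈ α, ∃ y ∈ β, x ≤ y`. -/
def ele (α β : Set ℝ*) : Prop := ∀ x ∈ α, ∃ y ∈ β, x ≤ y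

/-- `α` is non-negative: some element of `α` is `≥ 0`. -/
def eNonneg (α : Set ℝ*) : Prop := ∃ x ∈ α, (0 : ℝ*) ≤ x

/-- Absolute value of an external number: `|α| = |a| + A`. -/
def eabs (α : Set ℝ*) : Set ℝ* :=
  {z | ∃ a A, IsNeutrix A ∧ α = coset a A ∧ ∃ u ∈ A, z = |a| + u}

/-- Product of a finite family of external numbers. -/
def eprod : ∀ {n : ℕ}, (Fin n → Set ℝ*) → Set ℝ*
  | 0, _ => {1}
  | _ + 1, f => emul (f 0) (eprod fun i => f i.succ)

/-- Power of an external number. -/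
def epow (α : Set ℝ*) : ℕ → Set ℝ*
  | 0 => {1}
  | k + 1 => emul α (epow α k)

/-- Matrix product over external numbers: `(AB)_{ij} = Σ_k α_{ik}β_{kj}`. -/
def matMul {m n p : ℕ} (M : Matrix (Fin m) (Fin n) (Set ℝ*))
    (N : Matrix (Fin n) (Fin p) (Set ℝ*)) : Matrix (Fin m) (Fin p) (Set ℝ*) :=
  fun i j => ∑ k, emul (M i k) (N k j)

/-- Entrywise (Minkowski) sum of matrices over external numbers. -/
def matAdd {m n : ℕ} (M N : Matrix (Fin m) (Fin n) (Set ℝ*)) :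
    Matrix (Fin m) (Fin n) (Set ℝ*) := fun i j => M i j + N i j

/-- Entrywise scalar multiple of a matrix by an external number. -/
def matSmul {m n : ℕ} (α : Set ℝ*) (M : Matrix (Fin m) (Fin n) (Set ℝ*)) :
    Matrix (Fin m) (Fin n) (Set ℝ*) := fun i j => emul α (M i j)

/-- Entrywise inclusion of matrices over external numbers. -/
def matIncl {m n : ℕ} (M N : Matrix (Fin m) (Fin n) (Set ℝ*)) : Prop :=
  ∀ i j, M i j ⊆ N i j

/-- Determinant of a square matrix over the external numbers. -/
def detE {n : ℕ} (M : Matrix (Fin n) (Fin n) (Set ℝ*)) : Set ℝ* :=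
  ∑ σ : Equiv.Perm (Fin n),
    esmul ((Equiv.Perm.sign σ : ℤ) : ℝ*) (eprod fun i => M i (σ i))

/-- The `(i,j)` minor of a square matrix over the external numbers. -/
def minorE {n : ℕ} (M : Matrix (Fin (n + 1)) (Fin (n + 1)) (Set ℝ*))
    (i j : Fin (n + 1)) : Set ℝ* :=
  detE (M.submatrix i.succAbove j.succAbove)

/-- The near-identity matrix `I_n(N)`: diagonal entries `1 + N`, off-diagonal entries `N`. -/
def Iun (n : ℕ) (N : Set ℝ*) : Matrix (Fin n) (Fin n) (Set ℝ*) :=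
  fun i j => if i = j then coset 1 N else N

/-- A finite family of vectors of external numbers is linearly dependent:
some nontrivial real (hyperreal) linear combination is a neutrix vector. -/
def LinDepE {ι : Type*} [Fintype ι] {n : ℕ} (ξ : ι → Fin n → Set ℝ*) : Prop :=
  ∃ t : ι → ℝ*, (∃ i, t i ≠ 0) ∧ ∃ A : Fin n → Set ℝ*,
    (∀ j, IsNeutrix (A j)) ∧ ∀ j, (∑ i, esmul (t i) (ξ i j)) = A j

/-- The matrix has a zeroless minor of order `k`. -/
def HasZerolessMinor {m n : ℕ} (M : Matrix (Fin m) (Fin n) (Set ℝ*)) (k : ℕ) : Prop :=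
  ∃ (f : Fin k → Fin m) (g : Fin k → Fin n), Function.Injective f ∧ Function.Injective g ∧
    Zeroless (detE fun i j => M (f i) (g j))

/-- The minor rank of `M` is `r`. -/
def minorRankIs {m n : ℕ} (M : Matrix (Fin m) (Fin n) (Set ℝ*)) (r : ℕ) : Prop :=
  HasZerolessMinor M r ∧ ∀ k, HasZerolessMinor M k → k ≤ r

/-- The row rank of `M` is `r`: the maximal cardinality of a linearly
independent set of row vectors of `M` is `r`. -/
def rowRankIs {m n : ℕ} (M : Matrix (Fin m) (Fin n) (Set ℝ*)) (r : ℕ) : Prop :=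
  (∃ s : Finset (Fin m), s.card = r ∧ ¬ LinDepE fun (i : {x // x ∈ s}) j => M i.1 j) ∧
  ∀ s : Finset (Fin m), (¬ LinDepE fun (i : {x // x ∈ s}) j => M i.1 j) → s.card ≤ r

/-- `M` is a reduced matrix: `max_{i,j} |α_{ij}| = 1 + A₀` for some neutrix `A₀ ⊆ ⊘`. -/
def IsReducedMat {m n : ℕ} (M : Matrix (Fin m) (Fin n) (Set ℝ*)) : Prop :=
  ∃ A₀, IsNeutrix A₀ ∧ A₀ ⊆ oslash ∧ (∃ i j, eabs (M i j) = coset 1 A₀) ∧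
    ∀ i j, ele (eabs (M i j)) (coset 1 A₀)

/-- A neutrix contains every hyperreal that is at most as large in absolute value as one of its
elements. -/
theorem IsNeutrix.mem_of_abs_le {A : Set ℝ*} (hA : IsNeutrix A) {x z : ℝ*} (hx : x ∈ A)
    (h : |z| ≤ |x|) : z ∈ A := by
  obtain ⟨-, -, hneg, hconv⟩ := hA
  have hx' : |x| ∈ A := by
    rcases abs_choice x with h | h <;> rw [h]
    exacts [hx, hneg x hx]
  exact hconv _ (hneg _ hx') _ hx' z (abs_le.1 h).1 (abs_le.1 h).2

theorem isNeutrix_of_mem_of_abs_le {A : Set ℝ*} (h0 : (0 : ℝ*) ∈ A)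
    (hadd : ∀ x ∈ A, ∀ y ∈ A, x + y ∈ A) (h : ∀ x ∈ A, ∀ z : ℝ*, |z| ≤ |x| → z ∈ A) :
    IsNeutrix A := by
  refine ⟨h0, hadd, fun x hx => h x hx _ (abs_neg x).le, fun x hx y hy z hxz hzy => ?_⟩
  rcases le_total |x| |y| with hxy | hxy
  · exact h y hy z (abs_le_max_abs_abs hxz hzy |>.trans (max_le hxy le_rfl))
  · exact h x hx z (abs_le_max_abs_abs hxz hzy |>.trans (max_le le_rfl hxy))

theorem isNeutrix_singleton_zero : IsNeutrix {0} := by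
  refine isNeutrix_of_mem_of_abs_le rfl (by simp) ?_
  rintro x rfl z hz
  simpa using hz

theorem IsNeutrix.esmul {A : Set ℝ*} (hA : IsNeutrix A) (t : ℝ*) : IsNeutrix (esmul t A) := by
  refine isNeutrix_of_mem_of_abs_le ⟨0, hA.1, mul_zero t⟩ ?_ ?_
  · rintro _ ⟨x, hx, rfl⟩ _ ⟨y, hy, rfl⟩
    exact ⟨x + y, hA.2.1 x hx y hy, mul_add t x y⟩
  · rintro _ ⟨x, hx, rfl⟩ z hz
    simp only [abs_mul] at hz
    rcases eq_or_ne t 0 with rfl | ht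
    · exact ⟨0, hA.1, by simpa [eq_comm] using hz⟩
    · refine ⟨z / t, hA.mem_of_abs_le hx ?_, mul_div_cancel₀ z ht⟩
      rwa [abs_div, div_le_iff₀' (abs_pos.2 ht)]

theorem IsNeutrix.add {A B : Set ℝ*} (hA : IsNeutrix A) (hB : IsNeutrix B) :
    IsNeutrix (A + B) := by
  refine isNeutrix_of_mem_of_abs_le ⟨0, hA.1, 0, hB.1, add_zero 0⟩ ?_ ?_
  · rintro _ ⟨x, hx, y, hy, rfl⟩ _ ⟨x', hx', y', hy', rfl⟩
    exact ⟨x + x', hA.2.1 x hx x' hx', y + y', hB.2.1 y hy y' hy', add_add_add_comm x x' y y'⟩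
  · rintro _ ⟨x, hx, y, hy, rfl⟩ z hz
    replace hz : |z| ≤ |x| + |y| := hz.trans (abs_add_le x y)
    rcases le_total |x| |y| with h | h
    · refine ⟨0, hA.1, z, hB.mem_of_abs_le (hB.2.1 y hy y hy) ?_, zero_add z⟩
      rw [← two_mul, abs_mul, abs_two]
      linarith
    · refine ⟨z, hA.mem_of_abs_le (hA.2.1 x hx x hx) ?_, 0, hB.1, add_zero z⟩
      rw [← two_mul, abs_mul, abs_two]
      linarith

theorem IsNeutrix.mul {A B : Set ℝ*} (hA : IsNeutrix A) (hB : IsNeutrix B) :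
    IsNeutrix (A * B) := by
  have hsolid : ∀ x ∈ A * B, ∀ z : ℝ*, |z| ≤ |x| → z ∈ A * B := by
    rintro _ ⟨u, hu, v, hv, rfl⟩ z hz
    obtain ⟨w, hw, rfl⟩ := ((hB.esmul u).mem_of_abs_le ⟨v, hv, rfl⟩ hz)
    exact ⟨u, hu, w, hw, rfl⟩
  refine isNeutrix_of_mem_of_abs_le ⟨0, hA.1, 0, hB.1, mul_zero 0⟩ ?_ hsolid
  have hmax : ∀ {C : Set ℝ*}, ∀ x ∈ C, ∀ y ∈ C, ∃ w ∈ C, |x| ≤ |w| ∧ |y| ≤ |w| := by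
    intro C x hx y hy
    rcases le_total |x| |y| with h | h
    exacts [⟨y, hy, h, le_rfl⟩, ⟨x, hx, le_rfl, h⟩]
  rintro _ ⟨u, hu, v, hv, rfl⟩ _ ⟨u', hu', v', hv', rfl⟩
  obtain ⟨p, hp, hup, hup'⟩ := hmax u hu u' hu'
  obtain ⟨q, hq, hvq, hvq'⟩ := hmax v hv v' hv'
  refine hsolid (p * (q + q)) ⟨p, hp, q + q, hB.2.1 q hq q hq, rfl⟩ _ ?_
  calc |u * v + u' * v'| ≤ |u| * |v| + |u'| * |v'| := by
        simpa only [abs_mul] using abs_add_le (u * v) (u' * v')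
    _ ≤ |p| * |q| + |p| * |q| := by gcongr
    _ = |p * (q + q)| := by rw [← two_mul q, abs_mul, abs_mul, abs_two]; ring

theorem mem_coset_self {A : Set ℝ*} (hA : IsNeutrix A) (a : ℝ*) : a ∈ coset a A :=
  ⟨0, hA.1, (add_zero a).symm⟩

theorem IsNeutrix.sub_mem {A : Set ℝ*} (hA : IsNeutrix A) {x y : ℝ*} (hx : x ∈ A) (hy : y ∈ A) :
    x - y ∈ A :=
  sub_eq_add_neg x y ▸ hA.2.1 x hx _ (hA.2.2.1 y hy)

theorem coset_eq_of_mem {A : Set ℝ*} (hA : IsNeutrix A) {a x : ℝ*} (hx : x ∈ coset a A) :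
    coset a A = coset x A := by
  obtain ⟨u, hu, rfl⟩ := hx
  ext z
  constructor
  · rintro ⟨v, hv, rfl⟩
    exact ⟨v - u, hA.sub_mem hv hu, by ring⟩
  · rintro ⟨v, hv, rfl⟩
    exact ⟨u + v, hA.2.1 u hu v hv, by ring⟩

theorem Nx_coset {A : Set ℝ*} (hA : IsNeutrix A) (a : ℝ*) : Nx (coset a A) = A := by
  ext z
  constructor
  · rintro ⟨_, ⟨u, hu, rfl⟩, _, ⟨v, hv, rfl⟩, rfl⟩
    simpa using hA.sub_mem hu hv
  · exact fun hz => ⟨a + z, ⟨z, hz, rfl⟩, a, mem_coset_self hA a, by ring⟩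

theorem emul_coset {A B : Set ℝ*} (hA : IsNeutrix A) (hB : IsNeutrix B) (a b : ℝ*) :
    emul (coset a A) (coset b B) = coset (a * b) (esmul a B + esmul b A + A * B) := by
  ext z
  constructor
  · rintro ⟨a', A', b', B', hA', hB', ha, hb, u, hu, v, hv, u', hu', v', hv', rfl⟩
    obtain rfl : A = A' := by rw [← Nx_coset hA a, ha, Nx_coset hA']
    obtain rfl : B = B' := by rw [← Nx_coset hB b, hb, Nx_coset hB']
    obtain ⟨p, hp, rfl⟩ : a' ∈ coset a A := ha ▸ mem_coset_self hA a'
    obtain ⟨q, hq, rfl⟩ : b' ∈ coset b B := hb ▸ mem_coset_self hB b'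
    have hAB := (hA.mul hB).2.1
    refine ⟨_, ⟨_, ⟨_, ⟨q + v, hB.2.1 q hq v hv, rfl⟩, _, ⟨p + u, hA.2.1 p hp u hu, rfl⟩, rfl⟩, _,
      hAB _ (hAB (p * (q + v)) ⟨p, hp, _, hB.2.1 q hq v hv, rfl⟩ (u * q) ⟨u, hu, q, hq, rfl⟩)
        (u' * v') ⟨u', hu', v', hv', rfl⟩, rfl⟩, ?_⟩
    ring
  · rintro ⟨_, ⟨_, ⟨_, ⟨v, hv, rfl⟩, _, ⟨u, hu, rfl⟩, rfl⟩, _, ⟨u', hu', v', hv', rfl⟩, rfl⟩, rfl⟩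
    exact ⟨a, A, b, B, hA, hB, rfl, rfl, u, hu, v, hv, u', hu', v', hv', by ring⟩

theorem IsExt.emul {α β : Set ℝ*} (hα : IsExt α) (hβ : IsExt β) : IsExt (emul α β) := by
  obtain ⟨a, A, hA, rfl⟩ := hα
  obtain ⟨b, B, hB, rfl⟩ := hβ
  exact ⟨_, _, ((hB.esmul a).add (hA.esmul b)).add (hA.mul hB), emul_coset hA hB a b⟩

theorem mul_mem_emul {α β : Set ℝ*} (hα : IsExt α) (hβ : IsExt β) {x y : ℝ*} (hx : x ∈ α)
    (hy : y ∈ β) : x * y ∈ emul α β := by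
  obtain ⟨a, A, hA, rfl⟩ := hα
  obtain ⟨b, B, hB, rfl⟩ := hβ
  exact ⟨x, A, y, B, hA, hB, coset_eq_of_mem hA hx, coset_eq_of_mem hB hy, 0, hA.1, 0, hB.1, 0,
    hA.1, 0, hB.1, by ring⟩

theorem isExt_eprod {n : ℕ} {f : Fin n → Set ℝ*} (hf : ∀ i, IsExt (f i)) : IsExt (eprod f) := by
  induction n with
  | zero => exact ⟨1, {0}, isNeutrix_singleton_zero, by ext; simp [eprod, coset]⟩
  | succ n ih => exact (hf 0).emul (ih fun i => hf i.succ)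

theorem prod_mem_eprod {n : ℕ} {f : Fin n → Set ℝ*} (hf : ∀ i, IsExt (f i)) {x : Fin n → ℝ*}
    (hx : ∀ i, x i ∈ f i) : ∏ i, x i ∈ eprod f := by
  induction n with
  | zero => simp [eprod]
  | succ n ih =>
    rw [Fin.prod_univ_succ]
    exact mul_mem_emul (hf 0) (isExt_eprod fun i => hf i.succ) (hx 0)
      (ih (fun i => hf i.succ) fun i => hx i.succ)

/-- The determinant of a matrix of representatives represents the determinant. -/
theorem det_mem_detE {n : ℕ} {M : Matrix (Fin n) (Fin n) (Set ℝ*)} (hM : ∀ i j, IsExt (M i j))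
    {a : Matrix (Fin n) (Fin n) ℝ*} (ha : ∀ i j, a i j ∈ M i j) : a.det ∈ detE M := by
  rw [← Matrix.det_transpose, Matrix.det_apply', detE]
  exact Set.finsetSum_mem_finsetSum _ _ _ fun σ _ =>
    ⟨_, prod_mem_eprod (fun i => hM i (σ i)) fun i => ha i (σ i), rfl⟩

theorem stmt16 {n : ℕ} (A : Matrix (Fin n) (Fin n) (Set ℝ*)) (hA : ∀ i j, IsExt (A i j))
    (hns : Zeroless (detE A)) :
    ¬ LinDepE (fun i j => A i j) := by
  rintro ⟨t, ⟨k, hk⟩, N, hN, hsum⟩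
  have hzero : ∀ j, ∃ a : Fin n → ℝ*, (∀ i, a i ∈ A i j) ∧ ∑ i, t i * a i = 0 := by
    intro j
    have h0 : (0 : ℝ*) ∈ ∑ i, esmul (t i) (A i j) := (hsum j).symm ▸ (hN j).1
    obtain ⟨g, hg, hg0⟩ := (Set.mem_fintype_sum _ _).1 h0
    choose a ha hag using hg
    exact ⟨a, ha, by rw [← hg0]; exact Finset.sum_congr rfl fun i _ => hag i⟩
  choose a ha ha0 using hzero
  have hdet : (Matrix.of fun i j => a j i).det = 0 :=
    Matrix.exists_vecMul_eq_zero_iff.1 ⟨t, fun h => hk (congrFun h k), funext ha0⟩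
  exact hns (hdet ▸ det_mem_detE hA fun i j => ha j i)
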